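/- Let G be a finite irreducible subgroup of O(3) that is not contained in SO(3), and suppose that the matrix -I does not belong to G. Then G is isomorphic as an abstract group to the symmetric group S₄ on 4 letters. -/

import Mathlib

open Matrix
open MulAction

theorem orbit_data_of_le {N a b c l m n : ℕ} (ha : a * l = N) (hb : b * m = N)
    (hc : c * n = N) (hl : 2 ≤ l) (hlm : l ≤ m) (hmn : m ≤ n) (hc3 : 3 ≤ c)
    (hsum : a + b + c = N + 2)
    (hodd : a * (if Odd l then l - 1 else 0) + b * (if Odd m then m - 1 else 0) +
      c * (if Odd n then n - 1 else 0) + 2 ≤ N) :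
    N = 24 ∧ l = 2 ∧ m = 3 ∧ n = 4 := by
  have hl2 : l = 2 := by
    by_contra h
    have : 3 ≤ l := by omega
    nlinarith
  subst hl2
  have hm3 : m = 3 := by
    have h1 : m ≠ 2 := by
      rintro rfl
      omega
    by_contra h
    have : 4 ≤ m := by omega
    nlinarith
  subst hm3
  have hn : n < 6 := by
    by_contra h
    have : 6 ≤ n := by omega
    nlinarith
  interval_cases n <;> simp [Nat.odd_iff] at hodd <;> omega

theorem orbit_data {N a b c l m n : ℕ} (ha : a * l = N) (hb : b * m = N)
    (hc : c * n = N) (hl : 2 ≤ l) (hm : 2 ≤ m) (hn : 2 ≤ n)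
    (ha3 : 3 ≤ a) (hb3 : 3 ≤ b) (hc3 : 3 ≤ c) (hsum : a + b + c = N + 2)
    (hodd : a * (if Odd l then l - 1 else 0) + b * (if Odd m then m - 1 else 0) +
      c * (if Odd n then n - 1 else 0) + 2 ≤ N) :
    N = 24 ∧ ((l = 3 ∧ m ≠ 3 ∧ n ≠ 3) ∨ (l ≠ 3 ∧ m = 3 ∧ n ≠ 3) ∨
      (l ≠ 3 ∧ m ≠ 3 ∧ n = 3)) := by
  rcases le_total l m with h1 | h1 <;> rcases le_total m n with h2 | h2 <;>
    rcases le_total l n with h3 | h3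
  · have := orbit_data_of_le ha hb hc hl h1 h2 hc3 (by omega) (by omega); omega
  · have := orbit_data_of_le ha hb hc hl h1 h2 hc3 (by omega) (by omega); omega
  · have := orbit_data_of_le ha hc hb hl h3 h2 hb3 (by omega) (by omega); omega
  · have := orbit_data_of_le hc ha hb hn h3 h1 hb3 (by omega) (by omega); omega
  · have := orbit_data_of_le hb ha hc hm h1 h3 hc3 (by omega) (by omega); omega
  · have := orbit_data_of_le hb hc ha hm h2 h3 ha3 (by omega) (by omega); omega
  · have := orbit_data_of_le hc hb ha hn h2 h1 ha3 (by omega) (by omega); omega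
  · have := orbit_data_of_le hc hb ha hn h2 h1 ha3 (by omega) (by omega); omega

theorem two_mul_card_eq_sum {G P : Type*} [Group G] [Fintype P] [MulAction G P]
    [DecidableEq P]
    (hfix : ∀ g : G, g ≠ 1 → Nat.card (fixedBy P g) = 2) (S : Finset G) (hS : 1 ∉ S) :
    2 * S.card = ∑ p : P, (S.filter fun g => g • p = p).card := by
  have h := Finset.sum_card_bipartiteAbove_eq_sum_card_bipartiteBelow
    (s := S) (t := (Finset.univ : Finset P)) (fun g p => g • p = p)
  simp only [Finset.bipartiteAbove, Finset.bipartiteBelow] at h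
  rw [← h, Finset.sum_const_nat (m := 2), mul_comm]
  intro g hg
  rw [← hfix g (by rintro rfl; exact hS hg)]
  exact (Nat.subtype_card _ (by simp [fixedBy])).symm

theorem stabilizer_le_of_odd {G P : Type*} [Group G] [MulAction G P]
    {K : Subgroup G} (hK : K.index = 2) {p : P} (hp : Odd (Nat.card (stabilizer G p))) :
    stabilizer G p ≤ K := by
  intro g hg
  obtain ⟨k, hk⟩ := hp
  have h1 : g ^ (2 * k + 1) = 1 := by
    rw [← hk]
    exact congrArg Subtype.val (pow_card_eq_one' (x := (⟨g, hg⟩ : stabilizer G p)))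
  rw [pow_succ, pow_mul] at h1
  have h2 : (g ^ 2) ^ k ∈ K := K.pow_mem (Subgroup.sq_mem_of_index_two hK g) k
  exact (K.mul_mem_cancel_left h2).1 (h1 ▸ K.one_mem)

theorem natCard_orbit_mul_natCard_stabilizer (G : Type*) {P : Type*} [Group G] [MulAction G P]
    (p : P) : Nat.card (orbit G p) * Nat.card (stabilizer G p) = Nat.card G := by
  rw [Nat.card_coe_set_eq, ← index_stabilizer, Subgroup.index_mul_card]

theorem card_stabilizer_eq_of_mem_orbit {G P : Type*} [Group G] [MulAction G P] {p q : P}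
    (h : p ∈ orbit G q) : Nat.card (stabilizer G p) = Nat.card (stabilizer G q) := by
  obtain ⟨g, rfl⟩ := h
  exact (Nat.card_congr (stabilizerEquivStabilizer (g := g) (a := q) rfl).toEquiv).symm

theorem sum_eq_sum_orbits {G P : Type*} [Group G] [Fintype P] [MulAction G P]
    [Fintype (orbitRel.Quotient G P)] (f : ℕ → ℕ) :
    ∑ p : P, f (Nat.card (stabilizer G p)) = ∑ ω : orbitRel.Quotient G P,
      Nat.card (orbit G ω.out) * f (Nat.card (stabilizer G ω.out)) := by
  classical
  rw [← Finset.sum_fiberwise Finset.univ (fun p : P => (Quotient.mk _ p : orbitRel.Quotient G P))]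
  refine Finset.sum_congr rfl fun ω _ => ?_
  have key (p : P) : (Quotient.mk _ p : orbitRel.Quotient G P) = ω ↔ p ∈ orbit G ω.out := by
    rw [← orbitRel_apply, ← Quotient.eq, Quotient.out_eq]
  rw [Finset.sum_const_nat (m := f (Nat.card (stabilizer G ω.out)))]
  · congr 1
    exact (Nat.subtype_card _ (by simp [key])).symm
  · intro p hp
    rw [card_stabilizer_eq_of_mem_orbit ((key p).1 (by simpa using hp))]

theorem card_eq_of_two_fixed_points {G P : Type*} [Group G] [Finite G] [Finite P]
    [MulAction G P] (hfix : ∀ g : G, g ≠ 1 → Nat.card (fixedBy P g) = 2)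
    (hstab : ∀ p : P, ∃ g : G, g ≠ 1 ∧ g • p = p)
    (horb : ∀ p : P, 3 ≤ Nat.card (orbit G p)) {K : Subgroup G} (hK : K.index = 2) :
    Nat.card G = 24 ∧ ∃ p : P, Nat.card (stabilizer G p) = 3 ∧
      ∀ q : P, Nat.card (stabilizer G q) = 3 → q ∈ orbit G p := by
  classical
  have := Fintype.ofFinite G
  have := Fintype.ofFinite P
  have := Fintype.ofFinite (orbitRel.Quotient G P)
  have hKcard : Nat.card K * 2 = Nat.card G := hK ▸ K.card_mul_index
  have hKpos : 0 < Nat.card K := Nat.card_pos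
  have hmul := natCard_orbit_mul_natCard_stabilizer G (P := P)
  have hstab2 (p : P) : 2 ≤ Nat.card (stabilizer G p) := by
    obtain ⟨g, hg, hgp⟩ := hstab p
    have : Nontrivial (stabilizer G p) :=
      ⟨⟨⟨g, hgp⟩, 1, fun h => hg (congrArg Subtype.val h)⟩⟩
    exact Finite.one_lt_card
  have hcount (L : Subgroup G) (p : P) (hL : stabilizer G p ≤ L) :
      (((Finset.univ.filter (· ∈ L)).erase 1).filter fun g => g • p = p).card =
        Nat.card (stabilizer G p) - 1 := by
    rw [Finset.filter_erase, Finset.card_erase_of_mem (by simp [L.one_mem]), Finset.filter_filter]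
    congr 1
    refine (Nat.subtype_card _ fun g => ?_).symm
    simpa using fun h => hL h
  have hcardL (L : Subgroup G) :
      ((Finset.univ.filter (· ∈ L)).erase 1).card = Nat.card L - 1 := by
    rw [Finset.card_erase_of_mem (by simp [L.one_mem])]
    congr 1
    exact (Nat.subtype_card _ (by simp)).symm
  have hG := two_mul_card_eq_sum hfix ((Finset.univ.filter (· ∈ (⊤ : Subgroup G))).erase 1)
    (by simp)
  rw [hcardL, Finset.sum_congr rfl fun p _ => hcount ⊤ p le_top,
    sum_eq_sum_orbits (fun n => n - 1), Subgroup.card_top] at hG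
  have hodd := two_mul_card_eq_sum hfix ((Finset.univ.filter (· ∈ K)).erase 1) (by simp)
  rw [hcardL] at hodd
  have hle : ∑ p : P, (fun n => if Odd n then n - 1 else 0) (Nat.card (stabilizer G p)) ≤
      2 * (Nat.card K - 1) := by
    rw [hodd]
    refine Finset.sum_le_sum fun p _ => ?_
    dsimp only
    split_ifs with h
    · rw [hcount K p (stabilizer_le_of_odd hK h)]
    · exact Nat.zero_le _
  rw [sum_eq_sum_orbits (fun n => if Odd n then n - 1 else 0)] at hle
  have hterm (ω : orbitRel.Quotient G P) :
      Nat.card (orbit G ω.out) * (Nat.card (stabilizer G ω.out) - 1) +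
        Nat.card (orbit G ω.out) = Nat.card G := by
    rw [← hmul ω.out, ← Nat.mul_succ, Nat.succ_eq_add_one,
      Nat.sub_add_cancel (by have := hstab2 ω.out; omega)]
  have hcard : Fintype.card (orbitRel.Quotient G P) = 3 := by
    have hup : ∑ ω : orbitRel.Quotient G P,
        Nat.card (orbit G ω.out) * (Nat.card (stabilizer G ω.out) - 1) ≤
        Fintype.card (orbitRel.Quotient G P) * (Nat.card G - 3) := by
      rw [← smul_eq_mul, ← Finset.card_univ]
      refine Finset.sum_le_card_nsmul _ _ _ fun ω _ => ?_
      have := hterm ω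
      have := horb ω.out
      omega
    have hlow : Fintype.card (orbitRel.Quotient G P) * Nat.card K ≤ ∑ ω : orbitRel.Quotient G P,
        Nat.card (orbit G ω.out) * (Nat.card (stabilizer G ω.out) - 1) := by
      rw [← smul_eq_mul, ← Finset.card_univ]
      refine Finset.card_nsmul_le_sum _ _ _ fun ω _ => ?_
      have h1 := hterm ω
      have h2 := hmul ω.out
      have h3 := hstab2 ω.out
      nlinarith
    rw [← hG] at hup hlow
    generalize Fintype.card (orbitRel.Quotient G P) = r at *
    have h4 : r < 4 := by
      by_contra h
      have : 4 ≤ r := by omega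
      have : 4 * Nat.card K ≤ r * Nat.card K := Nat.mul_le_mul_right _ this
      omega
    interval_cases r <;> omega
  obtain ⟨e⟩ : Nonempty (Fin 3 ≃ orbitRel.Quotient G P) :=
    ⟨(Fintype.equivFinOfCardEq hcard).symm⟩
  rw [← e.sum_comp, Fin.sum_univ_three] at hG hle
  have h0 := hterm (e 0)
  have h1 := hterm (e 1)
  have h2 := hterm (e 2)
  obtain ⟨hN, h⟩ := orbit_data (hmul (e 0).out) (hmul (e 1).out) (hmul (e 2).out)
    (hstab2 _) (hstab2 _) (hstab2 _) (horb _) (horb _) (horb _) (by omega) (by omega)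
  refine ⟨hN, ?_⟩
  have hall (i : Fin 3) (hi : ∀ j, Nat.card (stabilizer G (e j).out) = 3 ↔ j = i) :
      ∃ p : P, Nat.card (stabilizer G p) = 3 ∧
      ∀ q : P, Nat.card (stabilizer G q) = 3 → q ∈ orbit G p := by
    refine ⟨(e i).out, (hi i).2 rfl, fun q hq => ?_⟩
    obtain ⟨j, hj⟩ := e.surjective (Quotient.mk _ q)
    have hmem : q ∈ orbit G (e j).out := by
      rw [← orbitRel_apply, ← Quotient.eq, Quotient.out_eq, hj]
    rw [card_stabilizer_eq_of_mem_orbit hmem] at hq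
    rwa [← (hi j).1 hq]
  rcases h with h | h | h
  · exact hall 0 fun j => by
      fin_cases j
      exacts [iff_of_true h.1 rfl, iff_of_false h.2.1 (by decide), iff_of_false h.2.2 (by decide)]
  · exact hall 1 fun j => by
      fin_cases j
      exacts [iff_of_false h.1 (by decide), iff_of_true h.2.1 rfl, iff_of_false h.2.2 (by decide)]
  · exact hall 2 fun j => by
      fin_cases j
      exacts [iff_of_false h.1 (by decide), iff_of_false h.2.1 (by decide), iff_of_true h.2.2 rfl]

theorem cross_mulVec_mulVec {R : Type*} [CommRing R] (A : Matrix (Fin 3) (Fin 3) R)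
    (u v : Fin 3 → R) : (A *ᵥ u) ⨯₃ (A *ᵥ v) = A.adjugateᵀ *ᵥ (u ⨯₃ v) := by
  ext i
  fin_cases i <;>
    simp [cross_apply, mulVec, dotProduct, Fin.sum_univ_three, adjugate_fin_three] <;> ring

section Rotation

variable {A : Matrix (Fin 3) (Fin 3) ℝ}

theorem exists_unit_fixed (hA : A * Aᵀ = 1) (hdet : A.det = 1) :
    ∃ v : Fin 3 → ℝ, v ⬝ᵥ v = 1 ∧ A *ᵥ v = v := by
  have h0 : (A - 1).det = 0 := by
    have h1 : A - 1 = A * -(A - 1)ᵀ := by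
      rw [transpose_sub, transpose_one, mul_neg, mul_sub, hA, mul_one, neg_sub]
    have h2 := congrArg det h1
    rw [det_mul, hdet, one_mul, det_neg, det_transpose] at h2
    norm_num at h2
    linarith
  obtain ⟨v, hv, hAv⟩ := exists_mulVec_eq_zero_iff.2 h0
  rw [sub_mulVec, one_mulVec, sub_eq_zero] at hAv
  have hpos : 0 < v ⬝ᵥ v := by
    simpa using dotProduct_star_self_pos_iff.2 hv
  refine ⟨(√(v ⬝ᵥ v))⁻¹ • v, ?_, by rw [mulVec_smul, hAv]⟩
  rw [smul_dotProduct, dotProduct_smul, smul_eq_mul, smul_eq_mul, ← mul_assoc, ← mul_inv,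
    Real.mul_self_sqrt hpos.le, inv_mul_cancel₀ hpos.ne']

theorem eq_one_of_fixed (hA : A * Aᵀ = 1) (hdet : A.det = 1) {u v : Fin 3 → ℝ}
    (hu : A *ᵥ u = u) (hv : A *ᵥ v = v) (huv : u ⨯₃ v ≠ 0) : A = 1 := by
  have hadj : A.adjugateᵀ = A := by
    have h : A.adjugate * (A * Aᵀ) = Aᵀ := by
      rw [← mul_assoc, adjugate_mul, hdet, one_smul, one_mul]
    rw [hA, mul_one] at h
    rw [h, transpose_transpose]
  have hw : A *ᵥ (u ⨯₃ v) = u ⨯₃ v := by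
    have := cross_mulVec_mulVec A u v
    rwa [hadj, hu, hv, eq_comm] at this
  have hM : of ![u, v, u ⨯₃ v] * Aᵀ = of ![u, v, u ⨯₃ v] * 1 := by
    rw [mul_one]
    ext i j
    have key (x : Fin 3 → ℝ) (hx : A *ᵥ x = x) : ∑ k, x k * A j k = x j := by
      conv_rhs => rw [← hx]
      simp [mulVec, dotProduct, mul_comm]
    rw [mul_apply]
    fin_cases i
    · exact key _ hu
    · exact key _ hv
    · exact key _ hw
  have hMdet : IsUnit (of ![u, v, u ⨯₃ v]).det := by
    have : (of ![u, v, u ⨯₃ v]).det = (u ⨯₃ v) ⬝ᵥ (u ⨯₃ v) := by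
      simp [det_fin_three, cross_apply, dotProduct, Fin.sum_univ_three]
      ring
    rw [this, isUnit_iff_ne_zero]
    exact fun h => huv (dotProduct_self_eq_zero.1 h)
  have := (isUnit_iff_isUnit_det _).2 hMdet |>.mul_left_cancel hM
  simpa using congrArg transpose this

theorem eq_or_eq_neg_of_cross_eq_zero {u v : Fin 3 → ℝ} (hu : u ⬝ᵥ u = 1) (hv : v ⬝ᵥ v = 1)
    (huv : u ⨯₃ v = 0) : v = u ∨ v = -u := by
  have h : v = (u ⬝ᵥ v) • u := by
    have h1 := cross_cross_eq_smul_sub_smul u v u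
    rw [huv, hu, one_smul, dotProduct_comm v u] at h1
    simpa [sub_eq_zero, eq_comm] using h1
  have h2 : (u ⬝ᵥ v) * (u ⬝ᵥ v) = 1 := by
    rw [h, smul_dotProduct, dotProduct_smul, hu] at hv
    simpa using hv
  rcases mul_self_eq_one_iff.1 h2 with h3 | h3 <;> rw [h3] at h
  · left; simpa using h
  · right; simpa using h

end Rotation

theorem specialOrthogonalGroup_mul_transpose (A : specialOrthogonalGroup (Fin 3) ℝ) :
    A.1 * A.1ᵀ = 1 :=
  (mem_orthogonalGroup_iff _ _).1 (mem_specialOrthogonalGroup_iff.1 A.2).1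

theorem specialOrthogonalGroup_det (A : specialOrthogonalGroup (Fin 3) ℝ) : A.1.det = 1 :=
  (mem_specialOrthogonalGroup_iff.1 A.2).2

theorem specialOrthogonalGroup_dotProduct_mulVec (A : specialOrthogonalGroup (Fin 3) ℝ)
    (v : Fin 3 → ℝ) :
    (A.1 *ᵥ v) ⬝ᵥ (A.1 *ᵥ v) = v ⬝ᵥ v := by
  rw [dotProduct_mulVec, vecMul_mulVec,
    mul_eq_one_comm.1 (specialOrthogonalGroup_mul_transpose A), vecMul_one]

/-- The unit vectors fixed by some `ρ g` with `g ≠ 1`. -/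
def Poles {G : Type*} [Group G] (ρ : G →* specialOrthogonalGroup (Fin 3) ℝ) : Type :=
  {v : Fin 3 → ℝ // v ⬝ᵥ v = 1 ∧ ∃ g : G, g ≠ 1 ∧ (ρ g).1 *ᵥ v = v}

namespace Poles

variable {G : Type*} [Group G] {ρ : G →* specialOrthogonalGroup (Fin 3) ℝ}

instance : MulAction G (Poles ρ) where
  smul g p := ⟨(ρ g).1 *ᵥ p.1, by rw [specialOrthogonalGroup_dotProduct_mulVec, p.2.1], by
    obtain ⟨h, hh, hp⟩ := p.2.2
    refine ⟨g * h * g⁻¹, by simpa using hh, ?_⟩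
    have : (ρ (g * h * g⁻¹)).1 * (ρ g).1 = (ρ g).1 * (ρ h).1 := by
      rw [← Submonoid.coe_mul, ← map_mul, inv_mul_cancel_right, map_mul, Submonoid.coe_mul]
    rw [mulVec_mulVec, this, ← mulVec_mulVec, hp]⟩
  one_smul p := Subtype.ext (by
    change (ρ 1).1 *ᵥ p.1 = p.1
    rw [map_one, Submonoid.coe_one, one_mulVec])
  mul_smul g h p := Subtype.ext (by
    change (ρ (g * h)).1 *ᵥ p.1 = (ρ g).1 *ᵥ ((ρ h).1 *ᵥ p.1)
    rw [map_mul, Submonoid.coe_mul, mulVec_mulVec])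

theorem coe_smul (g : G) (p : Poles ρ) : (g • p).1 = (ρ g).1 *ᵥ p.1 := rfl

instance : InvolutiveNeg (Poles ρ) where
  neg p := ⟨-p.1, by simpa using p.2.1, by
    obtain ⟨h, hh, hp⟩ := p.2.2
    exact ⟨h, hh, by rw [mulVec_neg, hp]⟩⟩
  neg_neg p := Subtype.ext (neg_neg p.1)

theorem coe_neg (p : Poles ρ) : (-p).1 = -p.1 := rfl

protected theorem smul_neg (g : G) (p : Poles ρ) : g • (-p) = -(g • p) :=
  Subtype.ext (mulVec_neg p.1 (ρ g).1)

theorem ne_neg (p : Poles ρ) : p ≠ -p := by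
  intro h
  have h0 : p.1 = 0 := self_eq_neg.1 (congrArg Subtype.val h)
  have := p.2.1
  simp [h0] at this

theorem exists_smul_eq (p : Poles ρ) : ∃ g : G, g ≠ 1 ∧ g • p = p := by
  obtain ⟨g, hg, hp⟩ := p.2.2
  exact ⟨g, hg, Subtype.ext hp⟩

theorem eq_or_eq_neg_of_smul_eq (hρ : Function.Injective ρ) {g : G} (hg : g ≠ 1)
    {p q : Poles ρ} (hp : g • p = p) (hq : g • q = q) : q = p ∨ q = -p := by
  have h : p.1 ⨯₃ q.1 = 0 := by
    by_contra h
    refine hg (hρ ?_)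
    rw [map_one]
    exact Subtype.ext (eq_one_of_fixed (specialOrthogonalGroup_mul_transpose _)
      (specialOrthogonalGroup_det _) (congrArg Subtype.val hp) (congrArg Subtype.val hq) h)
  exact (eq_or_eq_neg_of_cross_eq_zero p.2.1 q.2.1 h).imp Subtype.ext Subtype.ext

theorem exists_fixedBy_eq (hρ : Function.Injective ρ) {g : G} (hg : g ≠ 1) :
    ∃ p : Poles ρ, fixedBy (Poles ρ) g = {p, -p} := by
  obtain ⟨v, hv, hgv⟩ := exists_unit_fixed (specialOrthogonalGroup_mul_transpose (ρ g))
    (specialOrthogonalGroup_det _)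
  let p : Poles ρ := ⟨v, hv, g, hg, hgv⟩
  have hp : g • p = p := Subtype.ext hgv
  refine ⟨p, Set.ext fun q => ⟨eq_or_eq_neg_of_smul_eq hρ hg hp, ?_⟩⟩
  rintro (rfl | rfl)
  · exact hp
  · rw [mem_fixedBy, Poles.smul_neg, hp]

theorem card_fixedBy (hρ : Function.Injective ρ) {g : G} (hg : g ≠ 1) :
    Nat.card (fixedBy (Poles ρ) g) = 2 := by
  obtain ⟨p, hp⟩ := exists_fixedBy_eq hρ hg
  rw [hp, Nat.card_coe_set_eq, Set.ncard_pair (ne_neg p)]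

theorem finite (hρ : Function.Injective ρ) [Finite G] : Finite (Poles ρ) := by
  have h : (Set.univ : Set (Poles ρ)) ⊆ ⋃ g : {g : G // g ≠ 1}, fixedBy (Poles ρ) g.1 := by
    intro p _
    obtain ⟨g, hg, hp⟩ := exists_smul_eq p
    exact Set.mem_iUnion.2 ⟨⟨g, hg⟩, hp⟩
  refine Set.finite_univ_iff.1 ((Set.finite_iUnion fun g => ?_).subset h)
  obtain ⟨p, hp⟩ := exists_fixedBy_eq hρ g.2
  rw [hp]
  exact Set.toFinite _

theorem eq_or_eq_neg_of_card_orbit_le_two (hρ : Function.Injective ρ) [Finite G]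
    {p : Poles ρ} (h : Nat.card (orbit G p) ≤ 2) (g : G) : g • p = p ∨ g • p = -p := by
  by_contra! hne
  have := finite hρ
  obtain ⟨s, hs, hsp⟩ := exists_smul_eq p
  have hsg : s • g • p ≠ g • p := fun hq =>
    (eq_or_eq_neg_of_smul_eq hρ hs hsp hq).elim hne.1 hne.2
  have hsp' : s • g • p ≠ p := fun hq => hne.1 (by rwa [← hsp, smul_left_cancel_iff, hsp] at hq)
  have hsub : ({p, g • p, s • g • p} : Set (Poles ρ)) ⊆ orbit G p := by
    rintro q (rfl | rfl | rfl)
    · exact mem_orbit_self _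
    · exact mem_orbit _ _
    · exact ⟨s * g, mul_smul _ _ _⟩
  have hle := Set.ncard_le_ncard hsub (Set.toFinite _)
  rw [Set.ncard_eq_three.2 ⟨_, _, _, hne.1.symm, hsp'.symm, hsg.symm, rfl⟩,
    ← Nat.card_coe_set_eq] at hle
  omega

end Poles

/-- Only the zero matrix annihilates an invariant set of vectors containing a nonzero vector. -/
def OrbitsSpan {G : Type*} [Group G] (ρ : G →* specialOrthogonalGroup (Fin 3) ℝ) : Prop :=
  ∀ O : Set (Fin 3 → ℝ), (∀ g, ∀ v ∈ O, (ρ g).1 *ᵥ v ∈ O) → (∃ v ∈ O, v ≠ 0) →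
    ∀ M : Matrix (Fin 3) (Fin 3) ℝ, (∀ v ∈ O, M *ᵥ v = 0) → M = 0

namespace OrbitsSpan

variable {G : Type*} [Group G] {ρ : G →* specialOrthogonalGroup (Fin 3) ℝ}

open Poles

theorem eq_zero_of_orbit (hspan : OrbitsSpan ρ) (p : Poles ρ) (M : Matrix (Fin 3) (Fin 3) ℝ)
    (hM : ∀ q ∈ orbit G p, M *ᵥ q.1 = 0) : M = 0 := by
  refine hspan ((fun q : Poles ρ => q.1) '' orbit G p) ?_ ⟨p.1, ⟨p, mem_orbit_self p, rfl⟩, ?_⟩ M ?_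
  · rintro g _ ⟨q, hq, rfl⟩
    exact ⟨g • q, mapsTo_smul_orbit g p hq, rfl⟩
  · intro h0
    have := p.2.1
    simp [h0] at this
  · rintro _ ⟨q, hq, rfl⟩
    exact hM q hq

theorem three_le_card_orbit [Finite G] (hspan : OrbitsSpan ρ) (hρ : Function.Injective ρ)
    (p : Poles ρ) : 3 ≤ Nat.card (orbit G p) := by
  by_contra! h
  have key := eq_or_eq_neg_of_card_orbit_le_two hρ (p := p) (by omega)
  have h0 := hspan.eq_zero_of_orbit p (1 - vecMulVec p.1 p.1) (by
    rintro _ ⟨g, rfl⟩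
    have h1 : (1 - vecMulVec p.1 p.1) *ᵥ p.1 = 0 := by
      rw [sub_mulVec, one_mulVec, vecMulVec_mulVec, p.2.1]
      simp
    rcases key g with hg | hg <;> dsimp only <;> rw [hg]
    · exact h1
    · rw [coe_neg, mulVec_neg, h1, neg_zero])
  have h1 := congrArg trace h0
  rw [trace_sub, trace_vecMulVec, p.2.1, trace_one] at h1
  norm_num at h1

/-- An element acting by `±1` on an orbit whose stabilizers have order three is trivial. -/
theorem eq_one_of_smul_eq_or_eq_neg (hspan : OrbitsSpan ρ) (hρ : Function.Injective ρ)
    {p : Poles ρ} (hp : Nat.card (stabilizer G p) = 3) {g : G}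
    (hg : ∀ q ∈ orbit G p, g • q = q ∨ g • q = -q) : g = 1 := by
  by_cases h : ∃ q ∈ orbit G p, g • q = q
  · obtain ⟨q, hq, hgq⟩ := h
    have h3 : g ^ 3 = 1 := by
      rw [← hp, ← card_stabilizer_eq_of_mem_orbit hq]
      exact congrArg Subtype.val (pow_card_eq_one' (x := (⟨g, hgq⟩ : stabilizer G q)))
    have h2 : g ^ 2 = 1 := by
      have := hspan.eq_zero_of_orbit p ((ρ (g ^ 2)).1 - 1) (by
        intro r hr
        rw [sub_mulVec, one_mulVec, ← coe_smul, sub_eq_zero, pow_two, mul_smul]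
        rcases hg r hr with h | h
        · rw [h, h]
        · rw [h, Poles.smul_neg, h, neg_neg])
      apply hρ
      rw [map_one]
      exact Subtype.ext (sub_eq_zero.1 this)
    rwa [pow_succ, h2, one_mul] at h3
  · have := hspan.eq_zero_of_orbit p ((ρ g).1 + 1) (by
      intro r hr
      rw [add_mulVec, one_mulVec, ← coe_smul, (hg r hr).resolve_left fun h' => h ⟨r, hr, h'⟩,
        coe_neg, neg_add_cancel])
    have h1 := specialOrthogonalGroup_det (ρ g)
    rw [eq_neg_of_add_eq_zero_left this, det_neg] at h1
    norm_num at h1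

open scoped Pointwise in
theorem nonempty_mulEquiv_perm [Finite G] (hspan : OrbitsSpan ρ) (hρ : Function.Injective ρ)
    {K : Subgroup G} (hK : K.index = 2) : Nonempty (G ≃* Equiv.Perm (Fin 4)) := by
  classical
  have := finite hρ
  have := Fintype.ofFinite (Poles ρ)
  obtain ⟨hG, p, hp, hq⟩ := card_eq_of_two_fixed_points (P := Poles ρ)
    (fun g hg => card_fixedBy hρ hg) exists_smul_eq (hspan.three_le_card_orbit hρ) hK
  have hneg (q : Poles ρ) (h : q ∈ orbit G p) : -q ∈ orbit G p := by
    apply hq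
    rw [← hp, ← card_stabilizer_eq_of_mem_orbit h]
    congr! 2
    simp [mem_stabilizer_iff, Poles.smul_neg]
  let axis (q : Poles ρ) : Set (Poles ρ) := {q, -q}
  have haxis (q r : Poles ρ) : axis q = axis r ↔ q = r ∨ q = -r := by
    constructor
    · intro h
      have : q ∈ axis r := h ▸ Set.mem_insert q _
      exact this
    · rintro (rfl | rfl)
      · rfl
      · simp only [axis, neg_neg, Set.pair_comm]
  have hsmul (g : G) (q : Poles ρ) : g • axis q = axis (g • q) := by
    simp only [axis, Set.smul_set_insert, Set.smul_set_singleton, Poles.smul_neg]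
  have horbit : orbit G (axis p) = axis '' orbit G p := by
    ext a
    constructor
    · rintro ⟨g, rfl⟩
      exact ⟨g • p, mem_orbit p g, (hsmul g p).symm⟩
    · rintro ⟨_, ⟨g, rfl⟩, rfl⟩
      exact ⟨g, hsmul g p⟩
  have hcard : Nat.card (orbit G (axis p)) = 4 := by
    have h8 : Nat.card (orbit G p) = 8 := by
      have h := natCard_orbit_mul_natCard_stabilizer G p
      rw [hp] at h
      omega
    have h := Finset.card_eq_sum_card_image axis (orbit G p).toFinset
    rw [Finset.sum_const_nat (m := 2)] at h
    · rw [horbit, Nat.card_coe_set_eq, Set.ncard_eq_toFinset_card', Set.toFinset_image]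
      rw [Nat.card_eq_card_toFinset] at h8
      omega
    · intro a ha
      obtain ⟨q, hqp, rfl⟩ := Finset.mem_image.1 ha
      rw [Set.mem_toFinset] at hqp
      rw [← Finset.card_pair (ne_neg q)]
      congr 1
      ext r
      simp only [Finset.mem_filter, Set.mem_toFinset, haxis, Finset.mem_insert,
        Finset.mem_singleton, and_iff_right_iff_imp]
      rintro (rfl | rfl)
      · exact hqp
      · exact hneg q hqp
  have hinj : Function.Injective (toPermHom G (orbit G (axis p))) := by
    rw [injective_iff_map_eq_one]
    intro g hg
    refine hspan.eq_one_of_smul_eq_or_eq_neg hρ hp fun q hqp => ?_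
    have := congrArg Subtype.val
      (DFunLike.congr_fun hg ⟨axis q, horbit ▸ Set.mem_image_of_mem axis hqp⟩)
    rw [← haxis, ← hsmul]
    exact this
  have hcardPerm : Nat.card (Equiv.Perm (orbit G (axis p))) = 24 := by
    rw [Nat.card_perm, hcard]
    rfl
  have hbij := (Nat.bijective_iff_injective_and_card _).2 ⟨hinj, hG.trans hcardPerm.symm⟩
  exact ⟨(MulEquiv.ofBijective _ hbij).trans
    (Finite.equivFinOfCardEq hcard).permCongrHom⟩

end OrbitsSpan

/-- The rotation `det A • A` attached to an orthogonal `3 × 3` matrix `A`. -/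
def rotationPart : orthogonalGroup (Fin 3) ℝ →* specialOrthogonalGroup (Fin 3) ℝ where
  toFun A := ⟨A.1.det • A.1, by
    have h := (mem_orthogonalGroup_iff _ _).1 A.2
    have hdet : A.1.det * A.1.det = 1 := by simpa using congrArg det h
    rw [mem_specialOrthogonalGroup_iff, mem_orthogonalGroup_iff]
    constructor
    · rw [transpose_smul, smul_mul_smul_comm, h, hdet, one_smul]
    · rw [det_smul, Fintype.card_fin]
      linear_combination (A.1.det * A.1.det + 1) * hdet⟩
  map_one' := Subtype.ext (by simp)
  map_mul' A B := Subtype.ext (by simp [smul_smul, mul_comm])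

theorem det_eq_one_or_neg_one (A : orthogonalGroup (Fin 3) ℝ) :
    A.1.det = 1 ∨ A.1.det = -1 :=
  mul_self_eq_one_iff.1 (by simpa using congrArg det ((mem_orthogonalGroup_iff _ _).1 A.2))

theorem orbitsSpan_of_irreducible (G : Subgroup (orthogonalGroup (Fin 3) ℝ))
    (hirr : ∀ W : Submodule ℂ (Fin 3 → ℂ),
      (∀ g ∈ G, W.map (Matrix.toLin'
        (((g : Matrix (Fin 3) (Fin 3) ℝ)).map (algebraMap ℝ ℂ))) ≤ W) →
      W = ⊥ ∨ W = ⊤) : OrbitsSpan (rotationPart.comp G.subtype) := by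
  rintro O hO ⟨v, hvO, hv⟩ M hM
  let c (w : Fin 3 → ℝ) : Fin 3 → ℂ := fun i => (w i : ℂ)
  have hc (A : Matrix (Fin 3) (Fin 3) ℝ) (w : Fin 3 → ℝ) :
      A.map (algebraMap ℝ ℂ) *ᵥ c w = c (A *ᵥ w) :=
    funext fun i => (RingHom.map_mulVec (algebraMap ℝ ℂ) A w i).symm
  have htop : Submodule.span ℂ (c '' O) = ⊤ := by
    refine (hirr _ fun g hg => ?_).resolve_left fun hbot => hv ?_
    · rw [Submodule.map_span_le]
      rintro _ ⟨w, hw, rfl⟩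
      have hmem := Submodule.subset_span (R := ℂ) (Set.mem_image_of_mem c (hO ⟨g, hg⟩ w hw))
      change c ((g.1.det • g.1) *ᵥ w) ∈ _ at hmem
      rw [toLin'_apply, hc]
      rcases det_eq_one_or_neg_one g with h | h
      · rwa [h, one_smul] at hmem
      · rw [h, neg_one_smul, neg_mulVec] at hmem
        convert Submodule.neg_mem _ hmem using 1
        ext i
        simp [c]
    · have h0 : c v = 0 := by
        simpa [hbot] using Submodule.subset_span (R := ℂ) (Set.mem_image_of_mem c hvO)
      ext i
      simpa [c] using congrFun h0 i
  have hker : Submodule.span ℂ (c '' O) ≤ LinearMap.ker (toLin' (M.map (algebraMap ℝ ℂ))) := by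
    rw [Submodule.span_le]
    rintro _ ⟨w, hw, rfl⟩
    rw [SetLike.mem_coe, LinearMap.mem_ker, toLin'_apply, hc, hM w hw]
    ext i
    simp [c]
  rw [htop, top_le_iff, LinearMap.ker_eq_top, LinearEquiv.map_eq_zero_iff] at hker
  ext i j
  simpa using congrFun (congrFun hker i) j

theorem finite_irreducible_subgroup_of_O3_not_in_SO3_without_neg_one_is_S4
    (G : Subgroup (Matrix.orthogonalGroup (Fin 3) ℝ)) [Finite G]
    -- `G` is irreducible: the inclusion representation on `ℂ³` has no nontrivial
    -- invariant subspace
    (hirr : ∀ W : Submodule ℂ (Fin 3 → ℂ),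
      (∀ g ∈ G, W.map (Matrix.toLin'
        (((g : Matrix (Fin 3) (Fin 3) ℝ)).map (algebraMap ℝ ℂ))) ≤ W) →
      W = ⊥ ∨ W = ⊤)
    -- `G` is not contained in `SO(3)`
    (hnSO3 : ¬ ∀ g ∈ G, ((g : Matrix (Fin 3) (Fin 3) ℝ)).det = 1)
    -- `-I ∉ G`
    (hneg : ∀ g ∈ G, ((g : Matrix (Fin 3) (Fin 3) ℝ)) ≠ -1) :
    Nonempty (G ≃* Equiv.Perm (Fin 4)) := by
  have hinj : Function.Injective (rotationPart.comp G.subtype) := by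
    rw [injective_iff_map_eq_one]
    intro g hg
    have h : g.1.1.det • g.1.1 = 1 := congrArg Subtype.val hg
    rcases det_eq_one_or_neg_one g.1 with hd | hd <;> rw [hd] at h
    · rw [one_smul] at h
      exact Subtype.ext (Subtype.ext h)
    · rw [neg_one_smul] at h
      exact absurd (neg_eq_iff_eq_neg.1 h) (hneg g.1 g.2)
  let d : G →* ℝ := detMonoidHom.comp ((orthogonalGroup (Fin 3) ℝ).subtype.comp G.subtype)
  have hd (g : G) : d g = g.1.1.det := rfl
  push Not at hnSO3
  obtain ⟨a, haG, ha⟩ := hnSO3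
  have ha' := (det_eq_one_or_neg_one a).resolve_left ha
  have hindex : d.ker.index = 2 := by
    rw [Subgroup.index_eq_two_iff]
    refine ⟨⟨a, haG⟩, fun b => ?_⟩
    rw [MonoidHom.mem_ker, MonoidHom.mem_ker, map_mul, hd, hd, ha']
    rcases det_eq_one_or_neg_one b.1 with h | h <;> rw [h] <;> norm_num [xor_def]
  exact (orbitsSpan_of_irreducible G hirr).nonempty_mulEquiv_perm hinj hindex
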